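/- Let n and m be positive integers and let G be a strong graph in C_{n,m}. Then G is Whitney-maximum in C_{n,m}: for each connected simple graph H on n vertices and m edges there exists a nonnegative polynomial Q(x,y) such that W_G(x,y) - W_H(x,y) = (1 - xy)·Q(x,y). -/

import Mathlib

open MvPolynomial

/-- Number of connected components of the spanning subgraph of a graph on `Fin n`
whose edge set is `s`. -/
noncomputable def ncomp (n : ℕ) (s : Set (Sym2 (Fin n))) : ℕ :=
  Nat.card (SimpleGraph.fromEdgeSet s).ConnectedComponent

/-- `G` is a member of `C_{n,m}`: a connected simple graph on `n` vertices and `m` edges. -/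
def IsCnm (n m : ℕ) (G : SimpleGraph (Fin n)) : Prop :=
  G.Connected ∧ G.edgeSet.ncard = m

/-- `N_i^{(k)}(G)`: the number of spanning subgraphs of `G` (identified with subsets of
`E(G)`) having exactly `i` edges and at most `k` connected components. -/
noncomputable def Ncnt (n : ℕ) (G : SimpleGraph (Fin n)) (i k : ℕ) : ℕ :=
  Set.ncard {s : Set (Sym2 (Fin n)) | s ⊆ G.edgeSet ∧ s.ncard = i ∧ ncomp n s ≤ k}

/-- `N_{i,j}(G)`: the number of spanning subgraphs of `G` having exactly `i` edges and
exactly `j` connected components. -/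
noncomputable def Nexact (n : ℕ) (G : SimpleGraph (Fin n)) (i j : ℕ) : ℕ :=
  Set.ncard {s : Set (Sym2 (Fin n)) | s ⊆ G.edgeSet ∧ s.ncard = i ∧ ncomp n s = j}

/-- The `k`-reliability of `G` at `p`: `R_G^{(k)}(p) = Σ_{i=0}^m N_i^{(k)}(G) p^i (1-p)^{m-i}`. -/
noncomputable def rel (n m : ℕ) (G : SimpleGraph (Fin n)) (k : ℕ) (p : ℝ) : ℝ :=
  ∑ i ∈ Finset.range (m + 1), (Ncnt n G i k : ℝ) * p ^ i * (1 - p) ^ (m - i)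

/-- The Tutte polynomial of `G`, `T_G(x,y) = Σ_{H ∈ S(G)} (x-1)^{r(G)-r(H)} (y-1)^{c(H)}`,
where the rank of the spanning subgraph with edge set `s` is `n - ncomp n s`, so that
`r(G) - r(H) = ncomp n s - ncomp n G.edgeSet`, and the corank is `s.ncard + ncomp n s - n`. -/
noncomputable def tutte (n : ℕ) (G : SimpleGraph (Fin n)) : MvPolynomial (Fin 2) ℝ :=
  ∑ᶠ s ∈ {t : Set (Sym2 (Fin n)) | t ⊆ G.edgeSet},
    (X 0 - 1) ^ (ncomp n s - ncomp n G.edgeSet) * (X 1 - 1) ^ (s.ncard + ncomp n s - n)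

/-- The Whitney polynomial of `G`, `W_G(x,y) = Σ_{H ∈ S(G)} x^{r(G)-r(H)} y^{c(H)}`. -/
noncomputable def whitney (n : ℕ) (G : SimpleGraph (Fin n)) : MvPolynomial (Fin 2) ℝ :=
  ∑ᶠ s ∈ {t : Set (Sym2 (Fin n)) | t ⊆ G.edgeSet},
    X 0 ^ (ncomp n s - ncomp n G.edgeSet) * X 1 ^ (s.ncard + ncomp n s - n)

/-- A bivariate polynomial is nonnegative if all its coefficients are nonnegative. -/
def NonnegPoly (P : MvPolynomial (Fin 2) ℝ) : Prop :=
  ∀ d : Fin 2 →₀ ℕ, 0 ≤ P.coeff d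

/-- `G` is Tutte-maximum in `C_{n,m}`. -/
def TutteMaximum (n m : ℕ) (G : SimpleGraph (Fin n)) : Prop :=
  ∀ H : SimpleGraph (Fin n), IsCnm n m H →
    ∃ P : MvPolynomial (Fin 2) ℝ, NonnegPoly P ∧
      tutte n G - tutte n H = (X 0 + X 1 - X 0 * X 1) * P

/-- `G` is Whitney-maximum in `C_{n,m}`. -/
def WhitneyMaximum (n m : ℕ) (G : SimpleGraph (Fin n)) : Prop :=
  ∀ H : SimpleGraph (Fin n), IsCnm n m H →
    ∃ Q : MvPolynomial (Fin 2) ℝ, NonnegPoly Q ∧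
      whitney n G - whitney n H = (1 - X 0 * X 1) * Q

/-- `G` is strong in `C_{n,m}`. -/
def Strong (n m : ℕ) (G : SimpleGraph (Fin n)) : Prop :=
  ∀ H : SimpleGraph (Fin n), IsCnm n m H →
    ∀ i ≤ m, ∀ k, 1 ≤ k → k ≤ n → Ncnt n H i k ≤ Ncnt n G i k

/-- `G` is a 0-element in `C_{n,m}`. -/
def ZeroElement (n m : ℕ) (G : SimpleGraph (Fin n)) : Prop :=
  ∀ H : SimpleGraph (Fin n), IsCnm n m H → ∀ i ≤ m, Ncnt n H i 1 ≤ Ncnt n G i 1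

/-- `t_k(G)`: the number of spanning forests of `G` composed of exactly `k` trees. -/
noncomputable def tcount (n : ℕ) (G : SimpleGraph (Fin n)) (k : ℕ) : ℕ :=
  Set.ncard {s : Set (Sym2 (Fin n)) |
    s ⊆ G.edgeSet ∧ (SimpleGraph.fromEdgeSet s).IsAcyclic ∧ ncomp n s = k}

/-- `λ^{(k)}(G)`: the minimum number of edges that must be removed from `G` to obtain a
spanning subgraph with more than `k` connected components. -/
noncomputable def lamk (n : ℕ) (G : SimpleGraph (Fin n)) (k : ℕ) : ℕ :=
  sInf {d : ℕ | ∃ D : Set (Sym2 (Fin n)),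
    D ⊆ G.edgeSet ∧ D.ncard = d ∧ k < ncomp n (G.edgeSet \ D)}

/-- `∂^{a+b} P / ∂x^a ∂y^b` evaluated at `(0,0)`. -/
noncomputable def pdevalXY (P : MvPolynomial (Fin 2) ℝ) (a b : ℕ) : ℝ :=
  MvPolynomial.eval (fun _ => (0 : ℝ))
    ((fun q => MvPolynomial.pderiv (0 : Fin 2) q)^[a]
      ((fun q => MvPolynomial.pderiv (1 : Fin 2) q)^[b] P))

/-- A graph with `c` components on `v` vertices has at least `v - c` edges. -/
lemma card_le_ncard_edgeSet_add_card_connectedComponent {V : Type*} [Finite V]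
    (G : SimpleGraph V) :
    Nat.card V ≤ G.edgeSet.ncard + Nat.card G.ConnectedComponent := by
  classical
  rcases isEmpty_or_nonempty V with hV | ⟨⟨v₀⟩⟩
  · simp
  let c₀ := G.connectedComponentMk v₀
  let r : G.ConnectedComponent → V := Quot.out
  have hr : ∀ c, G.connectedComponentMk (r c) = c := fun c => Quot.out_eq c
  let T : Set (Sym2 V) := (fun c => s(r c₀, r c)) '' {c₀}ᶜ
  let G' := G ⊔ SimpleGraph.fromEdgeSet T
  have hreach : ∀ v, G'.Reachable (r c₀) v := by
    intro v
    have hv : G'.Reachable (r (G.connectedComponentMk v)) v :=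
      (SimpleGraph.ConnectedComponent.exact (hr (G.connectedComponentMk v))).mono le_sup_left
    refine SimpleGraph.Reachable.trans ?_ hv
    by_cases h : G.connectedComponentMk v = c₀
    · rw [h]
    · refine SimpleGraph.Adj.reachable (Or.inr ?_)
      rw [SimpleGraph.fromEdgeSet_adj]
      refine ⟨⟨_, h, rfl⟩, fun he => h ?_⟩
      rw [← hr (G.connectedComponentMk v), ← he, hr]
  have hconn : G'.Connected :=
    (SimpleGraph.connected_iff_exists_forall_reachable _).2 ⟨_, hreach⟩
  have h1 := hconn.card_vert_le_card_edgeSet_add_one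
  rw [Nat.card_coe_set_eq] at h1
  have h2 : G'.edgeSet.ncard ≤ G.edgeSet.ncard + T.ncard := by
    refine (Set.ncard_le_ncard ?_ (Set.toFinite _)).trans (Set.ncard_union_le _ _)
    rw [SimpleGraph.edgeSet_sup, SimpleGraph.edgeSet_fromEdgeSet]
    exact Set.union_subset_union_right _ Set.sdiff_subset
  have h3 : T.ncard ≤ ({c₀}ᶜ : Set G.ConnectedComponent).ncard :=
    Set.ncard_image_le (Set.toFinite _)
  have h4 := Set.ncard_add_ncard_compl ({c₀} : Set G.ConnectedComponent)
  rw [Set.ncard_singleton] at h4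
  omega

lemma le_ncard_add_ncomp (n : ℕ) (s : Set (Sym2 (Fin n))) : n ≤ s.ncard + ncomp n s := by
  have h := card_le_ncard_edgeSet_add_card_connectedComponent (SimpleGraph.fromEdgeSet s)
  rw [Nat.card_fin, SimpleGraph.edgeSet_fromEdgeSet] at h
  exact h.trans (Nat.add_le_add_right
    (Set.ncard_le_ncard Set.sdiff_subset (Set.toFinite _)) _)

lemma ncomp_le (n : ℕ) (s : Set (Sym2 (Fin n))) : ncomp n s ≤ n := by
  have h := Nat.card_le_card_of_surjective (SimpleGraph.fromEdgeSet s).connectedComponentMk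
    Quot.mk_surjective
  rwa [Nat.card_fin] at h

lemma ncomp_pos {n : ℕ} (hn : 0 < n) (s : Set (Sym2 (Fin n))) : 0 < ncomp n s := by
  have : Nonempty (SimpleGraph.fromEdgeSet s).ConnectedComponent :=
    ⟨(SimpleGraph.fromEdgeSet s).connectedComponentMk ⟨0, hn⟩⟩
  exact Nat.card_pos

lemma ncomp_edgeSet {n : ℕ} {G : SimpleGraph (Fin n)} (hG : G.Connected) :
    ncomp n G.edgeSet = 1 := by
  rw [ncomp, SimpleGraph.fromEdgeSet_edgeSet, Nat.card_eq_one_iff_unique]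
  have := hG.nonempty
  exact ⟨hG.preconnected.subsingleton_connectedComponent, inferInstance⟩

/-- Telescoping: a Whitney monomial is a monomial independent of the number `c` of components,
plus a multiple of `1 - x * y`. -/
lemma whitney_monomial_telescope {R : Type*} [CommRing R] (x y : R) {n c i : ℕ}
    (hc : 1 ≤ c) (hcn : c ≤ n) (hi : n ≤ i + c) :
    x ^ (c - 1) * y ^ (i + c - n) = x ^ (n - 1) * y ^ i +
      (1 - x * y) * ∑ k ∈ Finset.Ico 1 n, if c ≤ k then x ^ (k - 1) * y ^ (i + k - n) else 0 := by
  have hfilter : (Finset.Ico 1 n).filter (c ≤ ·) = Finset.Ico c n := by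
    ext k
    simp only [Finset.mem_filter, Finset.mem_Ico]
    omega
  rw [← Finset.sum_filter, hfilter, Finset.mul_sum]
  have hstep : ∀ k ∈ Finset.Ico c n, (1 - x * y) * (x ^ (k - 1) * y ^ (i + k - n)) =
      -(x ^ (k + 1 - 1) * y ^ (i + (k + 1) - n) - x ^ (k - 1) * y ^ (i + k - n)) := by
    intro k hk
    rw [Finset.mem_Ico] at hk
    obtain ⟨a, rfl⟩ : ∃ a, k = a + 1 := ⟨k - 1, by omega⟩
    have he : i + (a + 1 + 1) - n = i + (a + 1) - n + 1 := by omega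
    rw [he, Nat.add_sub_cancel, Nat.add_sub_cancel]
    ring
  rw [Finset.sum_congr rfl hstep, Finset.sum_neg_distrib,
    Finset.sum_Ico_sub (fun k => x ^ (k - 1) * y ^ (i + k - n)) hcn, Nat.add_sub_cancel]
  ring

/-- Expansion of the Whitney polynomial of a connected graph: all dependence on the graph beyond
the number of edges is in the coefficients `Ncnt n G i k`, multiplied by `1 - x * y`. -/
lemma whitney_eq {n m : ℕ} (hn : 0 < n) {G : SimpleGraph (Fin n)} (hG : IsCnm n m G) :
    whitney n G = ∑ i ∈ Finset.range (m + 1), m.choose i • (X 0 ^ (n - 1) * X 1 ^ i) +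
      (1 - X 0 * X 1) * ∑ k ∈ Finset.Ico 1 n, ∑ i ∈ Finset.range (m + 1),
        Ncnt n G i k • (X 0 ^ (k - 1) * X 1 ^ (i + k - n)) := by
  classical
  let E : Finset (Sym2 (Fin n)) := (Set.toFinite G.edgeSet).toFinset
  have hE : (E : Set (Sym2 (Fin n))) = G.edgeSet := Set.Finite.coe_toFinset _
  have hEcard : E.card = m := by rw [← Set.ncard_coe_finset, hE, hG.2]
  have hset : {t : Set (Sym2 (Fin n)) | t ⊆ G.edgeSet} =
      ↑(E.powerset.image ((↑) : Finset (Sym2 (Fin n)) → Set (Sym2 (Fin n)))) := by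
    ext t
    simp only [Set.mem_ofPred_eq, Finset.coe_image, Set.mem_image, Finset.mem_coe,
      Finset.mem_powerset]
    constructor
    · intro ht
      refine ⟨(Set.toFinite t).toFinset, ?_, Set.Finite.coe_toFinset _⟩
      rwa [← Finset.coe_subset, hE, Set.Finite.coe_toFinset]
    · rintro ⟨u, hu, rfl⟩
      rwa [← Finset.coe_subset, hE] at hu
  have hN : ∀ i k, Ncnt n G i k =
      ((E.powerset.filter fun t : Finset (Sym2 (Fin n)) => ncomp n t ≤ k).filter
        fun t => t.card = i).card := by
    intro i k
    rw [Ncnt, ← Finset.card_image_of_injective _ Finset.coe_injective, ← Set.ncard_coe_finset]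
    congr 1
    ext t
    constructor
    · rintro ⟨h1, h2, h3⟩
      have ht : t ∈ {t : Set (Sym2 (Fin n)) | t ⊆ G.edgeSet} := h1
      rw [hset, Finset.mem_coe, Finset.mem_image] at ht
      obtain ⟨u, hu, rfl⟩ := ht
      rw [Set.ncard_coe_finset] at h2
      simp only [Finset.coe_image, Set.mem_image, Finset.mem_coe, Finset.mem_filter]
      exact ⟨u, ⟨⟨hu, h3⟩, h2⟩, rfl⟩
    · simp only [Finset.coe_image, Set.mem_image, Finset.mem_coe, Finset.mem_filter]
      rintro ⟨u, ⟨⟨hu, h3⟩, h2⟩, rfl⟩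
      rw [Finset.mem_powerset, ← Finset.coe_subset, hE] at hu
      exact ⟨hu, by rw [Set.ncard_coe_finset, h2], h3⟩
  rw [whitney, hset, finsum_mem_coe_finset, Finset.sum_image Finset.coe_injective.injOn,
    ncomp_edgeSet hG.1]
  have hterm : ∀ t ∈ E.powerset,
      (X 0 ^ (ncomp n (t : Set (Sym2 (Fin n))) - 1) *
        X 1 ^ ((t : Set (Sym2 (Fin n))).ncard + ncomp n (t : Set (Sym2 (Fin n))) - n) :
        MvPolynomial (Fin 2) ℝ) = X 0 ^ (n - 1) * X 1 ^ t.card + (1 - X 0 * X 1) *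
        ∑ k ∈ Finset.Ico 1 n, if ncomp n (t : Set (Sym2 (Fin n))) ≤ k then
          X 0 ^ (k - 1) * X 1 ^ (t.card + k - n) else 0 := by
    intro t _
    rw [← Set.ncard_coe_finset]
    exact whitney_monomial_telescope _ _ (ncomp_pos hn _) (ncomp_le n _) (le_ncard_add_ncomp n _)
  rw [Finset.sum_congr rfl hterm, Finset.sum_add_distrib]
  refine congrArg₂ (· + ·) ?_ ?_
  · rw [Finset.sum_powerset_apply_card
      (fun i => (X 0 ^ (n - 1) * X 1 ^ i : MvPolynomial (Fin 2) ℝ)), hEcard]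
  · rw [← Finset.mul_sum, Finset.sum_comm]
    refine congrArg _ (Finset.sum_congr rfl fun k _ => ?_)
    rw [← Finset.sum_filter]
    have hmaps : ∀ t ∈ E.powerset.filter fun t : Finset (Sym2 (Fin n)) => ncomp n t ≤ k,
        t.card ∈ Finset.range (m + 1) := by
      intro t ht
      rw [Finset.mem_filter, Finset.mem_powerset] at ht
      rw [Finset.mem_range, Nat.lt_succ_iff, ← hEcard]
      exact Finset.card_le_card ht.1
    rw [← Finset.sum_fiberwise_of_maps_to hmaps]
    refine Finset.sum_congr rfl fun i _ => ?_
    rw [hN, ← Finset.sum_const]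
    refine Finset.sum_congr rfl fun t ht => ?_
    rw [(Finset.mem_filter.1 ht).2]

lemma NonnegPoly.sum {ι : Type*} {s : Finset ι} {f : ι → MvPolynomial (Fin 2) ℝ}
    (h : ∀ i ∈ s, NonnegPoly (f i)) : NonnegPoly (∑ i ∈ s, f i) := by
  intro d
  rw [MvPolynomial.coeff_sum]
  exact Finset.sum_nonneg fun i hi => h i hi d

lemma nonnegPoly_nsmul_X_pow_mul_X_pow (c a b : ℕ) :
    NonnegPoly (c • (X 0 ^ a * X 1 ^ b)) := by
  classical
  intro d
  rw [MvPolynomial.coeff_smul, X_pow_eq_monomial, X_pow_eq_monomial, monomial_mul,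
    coeff_monomial]
  split_ifs <;> simp

/-- each strong graph in `C_{n,m}` is Whitney-maximum. -/
theorem stmt11 (n m : ℕ) (hn : 0 < n) (hm : 0 < m) (G : SimpleGraph (Fin n))
    (hG : IsCnm n m G) (hS : Strong n m G) :
    WhitneyMaximum n m G := by
  intro H hH
  refine ⟨∑ k ∈ Finset.Ico 1 n, ∑ i ∈ Finset.range (m + 1),
    (Ncnt n G i k - Ncnt n H i k) • (X 0 ^ (k - 1) * X 1 ^ (i + k - n)),
    NonnegPoly.sum fun k _ => NonnegPoly.sum fun i _ => nonnegPoly_nsmul_X_pow_mul_X_pow _ _ _,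
    ?_⟩
  rw [whitney_eq hn hG, whitney_eq hn hH, add_sub_add_left_eq_sub, ← mul_sub,
    ← Finset.sum_sub_distrib]
  congr 1
  refine Finset.sum_congr rfl fun k hk => ?_
  rw [← Finset.sum_sub_distrib]
  refine Finset.sum_congr rfl fun i hi => ?_
  rw [Finset.mem_Ico] at hk
  rw [Finset.mem_range, Nat.lt_succ_iff] at hi
  rw [sub_eq_iff_eq_add, ← add_nsmul, Nat.sub_add_cancel (hS H hH i hi k hk.1 hk.2.le)]
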